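/- arXiv:2103.10467 — 2 statements merged into one kernel-verified Lean document; each statement's English description precedes it below -/
import Mathlib

section
/- Assume conditions (D1) and (D2) hold and every element of X belongs to some member of 𝓑. Suppose that for each j ∈ ℕ the function F_j : ℝⁿ × X → Y is asymptotically (R,𝓑)-multi-almost automorphic and that the sequence (F_j) converges to F : ℝⁿ × X → Y uniformly on ℝⁿ × X. Then F is asymptotically (R,𝓑)-multi-almost automorphic. -/
open Filter Topology MeasureTheory

noncomputable section

/-- `F : ℝⁿ × X → Y` is `(R, 𝓑)`-multi-almost automorphic. -/
def MultiAA {n : ℕ} {X Y : Type*} [NormedAddCommGroup X] [NormedAddCommGroup Y]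
    (R : Set (ℕ → EuclideanSpace ℝ (Fin n))) (𝓑 : Set (Set X))
    (F : EuclideanSpace ℝ (Fin n) → X → Y) : Prop :=
  Continuous (fun p : EuclideanSpace ℝ (Fin n) × X => F p.1 p.2) ∧
  ∀ B ∈ 𝓑, ∀ b ∈ R, ∃ k : ℕ → ℕ, StrictMono k ∧
    ∃ Fs : EuclideanSpace ℝ (Fin n) → X → Y,
      (∀ x ∈ B, ∀ t, Tendsto (fun l => F (t + b (k l)) x) atTop (𝓝 (Fs t x))) ∧
      (∀ x ∈ B, ∀ t, Tendsto (fun l => Fs (t - b (k l)) x) atTop (𝓝 (F t x)))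

/-- `F : ℝⁿ × X → Y` is compactly `(R, 𝓑)`-multi-almost automorphic: the two limits
converge uniformly in `t` on compact subsets of `ℝⁿ`, for each `x ∈ B`. -/
def CompactMultiAA {n : ℕ} {X Y : Type*} [NormedAddCommGroup X] [NormedAddCommGroup Y]
    (R : Set (ℕ → EuclideanSpace ℝ (Fin n))) (𝓑 : Set (Set X))
    (F : EuclideanSpace ℝ (Fin n) → X → Y) : Prop :=
  Continuous (fun p : EuclideanSpace ℝ (Fin n) × X => F p.1 p.2) ∧
  ∀ B ∈ 𝓑, ∀ b ∈ R, ∃ k : ℕ → ℕ, StrictMono k ∧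
    ∃ Fs : EuclideanSpace ℝ (Fin n) → X → Y,
      (∀ x ∈ B, ∀ K : Set (EuclideanSpace ℝ (Fin n)), IsCompact K →
        TendstoUniformlyOn (fun l t => F (t + b (k l)) x) (fun t => Fs t x) atTop K) ∧
      (∀ x ∈ B, ∀ K : Set (EuclideanSpace ℝ (Fin n)), IsCompact K →
        TendstoUniformlyOn (fun l t => Fs (t - b (k l)) x) (fun t => F t x) atTop K)

/-- `Q ∈ C_{0,ℝⁿ,𝓑}(ℝⁿ × X : Y)`: continuous and, for every `B ∈ 𝓑`, `Q(t;x) → 0` as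
`|t| → ∞`, uniformly for `x ∈ B`. -/
def C0B {n : ℕ} {X Y : Type*} [NormedAddCommGroup X] [NormedAddCommGroup Y]
    (𝓑 : Set (Set X)) (Q : EuclideanSpace ℝ (Fin n) → X → Y) : Prop :=
  Continuous (fun p : EuclideanSpace ℝ (Fin n) × X => Q p.1 p.2) ∧
  ∀ B ∈ 𝓑, ∀ ε > 0, ∃ r : ℝ, ∀ t : EuclideanSpace ℝ (Fin n), r ≤ ‖t‖ → ∀ x ∈ B, ‖Q t x‖ < ε

/-- `F` is asymptotically `(R,𝓑)`-multi-almost automorphic. -/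
def AsympMultiAA {n : ℕ} {X Y : Type*} [NormedAddCommGroup X] [NormedAddCommGroup Y]
    (R : Set (ℕ → EuclideanSpace ℝ (Fin n))) (𝓑 : Set (Set X))
    (F : EuclideanSpace ℝ (Fin n) → X → Y) : Prop :=
  ∃ G Q : EuclideanSpace ℝ (Fin n) → X → Y,
    MultiAA R 𝓑 G ∧ C0B 𝓑 Q ∧ ∀ t x, F t x = G t x + Q t x

theorem aux_diag (P : ℕ → (ℕ → ℕ) → Prop)
    (h : ∀ j k, StrictMono k → ∃ m : ℕ → ℕ, StrictMono m ∧ P j (k ∘ m))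
    (hP : ∀ j k e d, P j k → Tendsto e atTop atTop → (∀ᶠ l in atTop, d l = k (e l)) → P j d) :
    ∃ d : ℕ → ℕ, StrictMono d ∧ ∀ j, P j d := by
  choose m hm hmP using h
  let K : ℕ → {k : ℕ → ℕ // StrictMono k} := fun j => Nat.rec ⟨id, strictMono_id⟩
    (fun j k => ⟨k.1 ∘ m j k.1 k.2, k.2.comp (hm j k.1 k.2)⟩) j
  have hK : ∀ j, (K (j+1)).1 = (K j).1 ∘ m j (K j).1 (K j).2 := fun j => rfl
  have hPK : ∀ j, P j (K (j+1)).1 := fun j => by rw [hK]; exact hmP _ _ _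
  have hsub : ∀ j i, ∃ M : ℕ → ℕ, StrictMono M ∧ (K (j+i)).1 = (K j).1 ∘ M := by
    intro j i
    induction i with
    | zero => exact ⟨id, strictMono_id, rfl⟩
    | succ i ih =>
      obtain ⟨M, hM, hE⟩ := ih
      refine ⟨M ∘ m (j+i) (K (j+i)).1 (K (j+i)).2, hM.comp (hm _ _ _), ?_⟩
      rw [← add_assoc, hK, ← Function.comp_assoc, ← hE]
  refine ⟨fun l => (K l).1 l, strictMono_nat_of_lt_succ ?_, ?_⟩
  · intro l
    rw [hK]
    exact (K l).2 (lt_of_lt_of_le (Nat.lt_succ_self l) ((hm l _ (K l).2).le_apply))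
  · intro j
    have : ∀ l, ∃ e, l ≤ e ∧ (j + 1 ≤ l → (K l).1 l = (K (j+1)).1 e) := by
      intro l
      by_cases hl : j + 1 ≤ l
      · obtain ⟨i, rfl⟩ := Nat.exists_eq_add_of_le hl
        obtain ⟨M, hM, hE⟩ := hsub (j+1) i
        exact ⟨M (j+1+i), hM.le_apply, fun _ => by rw [hE]; rfl⟩
      · exact ⟨l, le_rfl, fun h => absurd h hl⟩
    choose e he1 he2 using this
    refine hP j _ e _ (hPK j) (tendsto_atTop_mono he1 tendsto_id) ?_
    filter_upwards [eventually_ge_atTop (j+1)] with l hl using he2 l hl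

theorem aux_cauchy {α Y : Type*} [NormedAddCommGroup Y] [CompleteSpace Y]
    (f : ℕ → α → Y) (s : Set α)
    (h : ∀ ε > 0, ∃ N : ℕ, ∀ i ≥ N, ∀ j ≥ N, ∀ a ∈ s, ‖f i a - f j a‖ ≤ ε) :
    ∃ g : α → Y, ∀ ε > 0, ∃ N : ℕ, ∀ i ≥ N, ∀ a ∈ s, ‖f i a - g a‖ ≤ ε := by
  have hl : ∀ a, ∃ y, a ∈ s → Tendsto (fun i => f i a) atTop (𝓝 y) := by
    intro a
    by_cases ha : a ∈ s
    · have : CauchySeq (fun i => f i a) := by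
        rw [Metric.cauchySeq_iff]
        intro ε hε
        obtain ⟨N, hN⟩ := h (ε/2) (by positivity)
        refine ⟨N, fun i hi j hj => ?_⟩
        rw [dist_eq_norm]
        linarith [hN i hi j hj a ha]
      obtain ⟨y, hy⟩ := cauchySeq_tendsto_of_complete this
      exact ⟨y, fun _ => hy⟩
    · exact ⟨0, fun h => absurd h ha⟩
  choose g hg using hl
  refine ⟨g, fun ε hε => ?_⟩
  obtain ⟨N, hN⟩ := h ε hε
  refine ⟨N, fun i hi a ha => ?_⟩
  refine le_of_tendsto ((tendsto_const_nhds.sub (hg a ha)).norm) ?_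
  filter_upwards [eventually_ge_atTop N] with j hj using hN i hi j hj a ha

theorem aux_swap {Y : Type*} [NormedAddCommGroup Y]
    (u : ℕ → ℕ → Y) (v a : ℕ → Y) (A : Y)
    (hu : ∀ j, Tendsto (u j) atTop (𝓝 (a j)))
    (h : ∀ ε > 0, ∃ j, (∀ l, ‖u j l - v l‖ ≤ ε) ∧ ‖a j - A‖ ≤ ε) :
    Tendsto v atTop (𝓝 A) := by
  rw [Metric.tendsto_atTop]
  intro ε hε
  obtain ⟨j, h1, h2⟩ := h (ε/4) (by positivity)
  obtain ⟨N, hN⟩ := (Metric.tendsto_atTop.1 (hu j)) (ε/4) (by positivity)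
  refine ⟨N, fun l hl => ?_⟩
  have h3 := hN l hl
  have h4 := h1 l
  rw [← dist_eq_norm] at h4 h2
  have := dist_triangle4 (v l) (u j l) (a j) A
  rw [dist_comm (v l) (u j l)] at this
  linarith

theorem aux_diagAA {n : ℕ} {X Y : Type*} [NormedAddCommGroup X] [NormedAddCommGroup Y]
    (R : Set (ℕ → EuclideanSpace ℝ (Fin n))) (𝓑 : Set (Set X))
    (hD2 : ∀ b ∈ R, ∀ k : ℕ → ℕ, StrictMono k → (fun j => b (k j)) ∈ R)
    (G : ℕ → EuclideanSpace ℝ (Fin n) → X → Y) (hG : ∀ j, MultiAA R 𝓑 (G j))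
    (B : Set X) (hB : B ∈ 𝓑) (b : ℕ → EuclideanSpace ℝ (Fin n)) (hb : b ∈ R) :
    ∃ d : ℕ → ℕ, StrictMono d ∧ ∃ Gs : ℕ → EuclideanSpace ℝ (Fin n) → X → Y, ∀ j,
      (∀ x ∈ B, ∀ t, Tendsto (fun l => G j (t + b (d l)) x) atTop (𝓝 (Gs j t x))) ∧
      (∀ x ∈ B, ∀ t, Tendsto (fun l => Gs j (t - b (d l)) x) atTop (𝓝 (G j t x))) := by
  obtain ⟨d, hd, h⟩ := aux_diag (fun j k => ∃ Fs : EuclideanSpace ℝ (Fin n) → X → Y,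
      (∀ x ∈ B, ∀ t, Tendsto (fun l => G j (t + b (k l)) x) atTop (𝓝 (Fs t x))) ∧
      (∀ x ∈ B, ∀ t, Tendsto (fun l => Fs (t - b (k l)) x) atTop (𝓝 (G j t x))))
    (fun j k hk => (hG j).2 B hB _ (hD2 b hb k hk)) (by
      rintro j k e d ⟨Fs, h1, h2⟩ he hde
      refine ⟨Fs, fun x hx t => ?_, fun x hx t => ?_⟩
      · refine ((h1 x hx t).comp he).congr' ?_
        filter_upwards [hde] with l hl
        simp [hl]
      · refine ((h2 x hx t).comp he).congr' ?_
        filter_upwards [hde] with l hl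
        simp [hl])
  choose Gs hGs using h
  exact ⟨d, hd, Gs, hGs⟩

theorem aux_unbdd {n : ℕ} (b : ℕ → EuclideanSpace ℝ (Fin n))
    (h : ∀ k : ℕ → ℕ, StrictMono k → ¬ Bornology.IsBounded (Set.range fun j => b (k j))) :
    Tendsto (fun l => ‖b l‖) atTop atTop := by
  by_contra hc
  rw [tendsto_atTop] at hc
  push Not at hc
  obtain ⟨r, hr⟩ := hc
  have hr' : ∃ᶠ l in atTop, ‖b l‖ < r := by
    simpa [Filter.Frequently, not_lt] using hr
  obtain ⟨k, hk, hkr⟩ := extraction_of_frequently_atTop hr'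
  refine h k hk ((isBounded_iff_forall_norm_le).2 ⟨r, ?_⟩)
  rintro _ ⟨j, rfl⟩
  exact (hkr j).le

/-- under (D1) and (D2), a uniform limit of asymptotically
`(R,𝓑)`-multi-almost automorphic functions is asymptotically `(R,𝓑)`-multi-almost
automorphic. -/
theorem asympMultiAA_of_uniform_limit {n : ℕ} {X Y : Type*}
    [NormedAddCommGroup X] [NormedSpace ℝ X] [CompleteSpace X]
    [NormedAddCommGroup Y] [NormedSpace ℝ Y] [CompleteSpace Y]
    (R : Set (ℕ → EuclideanSpace ℝ (Fin n))) (𝓑 : Set (Set X))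
    (hR : R.Nonempty) (h𝓑 : 𝓑.Nonempty)
    (hD1 : ∃ b ∈ R, ∀ k : ℕ → ℕ, StrictMono k →
      ¬ Bornology.IsBounded (Set.range fun j => b (k j)))
    (hD2 : ∀ b ∈ R, ∀ k : ℕ → ℕ, StrictMono k → (fun j => b (k j)) ∈ R)
    (hcov : ∀ x : X, ∃ B ∈ 𝓑, x ∈ B)
    (Fj : ℕ → EuclideanSpace ℝ (Fin n) → X → Y) (F : EuclideanSpace ℝ (Fin n) → X → Y)
    (hAA : ∀ j, AsympMultiAA R 𝓑 (Fj j))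
    (hconv : TendstoUniformly (fun j (p : EuclideanSpace ℝ (Fin n) × X) => Fj j p.1 p.2)
      (fun p => F p.1 p.2) atTop) :
    AsympMultiAA R 𝓑 F := by
  choose G Q hG hQ hFGQ using hAA
  have hF : ∀ ε > 0, ∃ N : ℕ, ∀ i ≥ N, ∀ t x, ‖Fj i t x - F t x‖ ≤ ε := by
    intro ε hε
    obtain ⟨N, hN⟩ := eventually_atTop.1 (Metric.tendstoUniformly_iff.1 hconv ε hε)
    refine ⟨N, fun i hi t x => ?_⟩
    have := hN i hi (t, x)
    rw [dist_comm, dist_eq_norm] at this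
    exact this.le
  have hFc : ∀ ε > 0, ∃ N : ℕ, ∀ i ≥ N, ∀ j ≥ N, ∀ t x, ‖Fj i t x - Fj j t x‖ ≤ ε := by
    intro ε hε
    obtain ⟨N, hN⟩ := hF (ε/2) (by positivity)
    refine ⟨N, fun i hi j hj t x => ?_⟩
    have h1 := hN i hi t x
    have h2 := hN j hj t x
    have := norm_sub_le (Fj i t x - F t x) (Fj j t x - F t x)
    rw [sub_sub_sub_cancel_right] at this
    linarith
  have hstar : ∀ (i j : ℕ) (ε : ℝ), (∀ t x, ‖Fj i t x - Fj j t x‖ ≤ ε) →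
      ∀ t x, ‖G i t x - G j t x‖ ≤ ε := by
    intro i j ε hε t x
    obtain ⟨b, hb, hunb⟩ := hD1
    obtain ⟨B, hB, hx⟩ := hcov x
    obtain ⟨d, hd, Gs, hGs⟩ := aux_diagAA R 𝓑 hD2 G hG B hB b hb
    have hinf : Tendsto (fun l => ‖b (d l)‖) atTop atTop :=
      (aux_unbdd b hunb).comp hd.tendsto_atTop
    have hq : ∀ i s, Tendsto (fun l => Q i (s + b (d l)) x) atTop (𝓝 0) := by
      intro i s
      rw [Metric.tendsto_atTop]
      intro δ hδ
      obtain ⟨r, hr⟩ := (hQ i).2 B hB δ hδ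
      obtain ⟨N, hN⟩ := eventually_atTop.1 (tendsto_atTop.1 hinf (r + ‖s‖))
      refine ⟨N, fun l hl => ?_⟩
      rw [dist_zero_right]
      refine hr _ ?_ x hx
      have h1 := hN l hl
      have h2 := norm_sub_le (s + b (d l)) s
      rw [add_sub_cancel_left] at h2
      linarith
    have hs : ∀ s, ‖Gs i s x - Gs j s x‖ ≤ ε := by
      intro s
      have h1 := (((hGs i).1 x hx s).add (hq i s)).sub (((hGs j).1 x hx s).add (hq j s))
      simp only [← hFGQ, add_zero] at h1
      exact le_of_tendsto h1.norm (Eventually.of_forall fun l => hε _ _)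
    exact le_of_tendsto (((hGs i).2 x hx t).sub ((hGs j).2 x hx t)).norm
      (Eventually.of_forall fun l => hs _)
  have hGc : ∀ ε > 0, ∃ N : ℕ, ∀ i ≥ N, ∀ j ≥ N, ∀ t x, ‖G i t x - G j t x‖ ≤ ε := by
    intro ε hε
    obtain ⟨N, hN⟩ := hFc ε hε
    exact ⟨N, fun i hi j hj => hstar i j ε (hN i hi j hj)⟩
  obtain ⟨g, hg⟩ := aux_cauchy
    (fun i (p : EuclideanSpace ℝ (Fin n) × X) => G i p.1 p.2) Set.univ (by
      intro ε hε
      obtain ⟨N, hN⟩ := hGc ε hε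
      exact ⟨N, fun i hi j hj p _ => hN i hi j hj p.1 p.2⟩)
  have unif : ∀ (f : ℕ → EuclideanSpace ℝ (Fin n) × X → Y) (g : EuclideanSpace ℝ (Fin n) × X → Y),
      (∀ j, Continuous (f j)) → (∀ ε > 0, ∃ N : ℕ, ∀ i ≥ N, ∀ p, ‖f i p - g p‖ ≤ ε) →
      Continuous g := by
    intro f g hf h
    have : TendstoUniformly f g atTop := by
      rw [Metric.tendstoUniformly_iff]
      intro ε hε
      obtain ⟨N, hN⟩ := h (ε/2) (by positivity)
      filter_upwards [eventually_ge_atTop N] with i hi p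
      rw [dist_comm, dist_eq_norm]
      linarith [hN i hi p]
    exact this.continuous (Eventually.of_forall hf).frequently
  have hgcont : Continuous g := unif _ g (fun j => (hG j).1) (by
    intro ε hε
    obtain ⟨N, hN⟩ := hg ε hε
    exact ⟨N, fun i hi p => hN i hi p trivial⟩)
  have hQl : ∀ ε > 0, ∃ N : ℕ, ∀ i ≥ N, ∀ t x, ‖Q i t x - (F t x - g (t, x))‖ ≤ ε := by
    intro ε hε
    obtain ⟨N, hN⟩ := hF (ε/2) (by positivity)
    obtain ⟨M, hM⟩ := hg (ε/2) (by positivity)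
    refine ⟨max N M, fun i hi t x => ?_⟩
    have h1 := hN i (le_trans (le_max_left _ _) hi) t x
    have h2 := hM i (le_trans (le_max_right _ _) hi) (t, x) trivial
    have h3 := norm_sub_le (Fj i t x - F t x) (G i t x - g (t, x))
    have h4 : Fj i t x - F t x - (G i t x - g (t, x)) = Q i t x - (F t x - g (t, x)) := by
      rw [hFGQ]; abel
    rw [h4] at h3
    simp only at h2
    linarith
  refine ⟨fun t x => g (t, x), fun t x => F t x - g (t, x), ⟨hgcont, ?_⟩, ⟨?_, ?_⟩, ?_⟩
  · intro B hB b hb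
    obtain ⟨d, hd, Gs, hGs⟩ := aux_diagAA R 𝓑 hD2 G hG B hB b hb
    obtain ⟨gs, hgs⟩ := aux_cauchy
      (fun i (p : EuclideanSpace ℝ (Fin n) × X) => Gs i p.1 p.2) {p | p.2 ∈ B} (by
        intro ε hε
        obtain ⟨N, hN⟩ := hGc ε hε
        refine ⟨N, fun i hi j hj p hp => ?_⟩
        exact le_of_tendsto (((hGs i).1 p.2 hp p.1).sub ((hGs j).1 p.2 hp p.1)).norm
          (Eventually.of_forall fun l => hN i hi j hj _ _))
    refine ⟨d, hd, fun t x => gs (t, x), fun x hx t => ?_, fun x hx t => ?_⟩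
    · refine aux_swap _ _ _ _ (fun j => (hGs j).1 x hx t) fun ε hε => ?_
      obtain ⟨N, hN⟩ := hg ε hε
      obtain ⟨M, hM⟩ := hgs ε hε
      exact ⟨max N M, fun l => hN _ (le_max_left _ _) (_, x) trivial,
        hM _ (le_max_right _ _) (t, x) hx⟩
    · refine aux_swap _ _ _ _ (fun j => (hGs j).2 x hx t) fun ε hε => ?_
      obtain ⟨N, hN⟩ := hg ε hε
      obtain ⟨M, hM⟩ := hgs ε hε
      exact ⟨max N M, fun l => hM _ (le_max_right _ _) (_, x) hx,
        hN _ (le_max_left _ _) (t, x) trivial⟩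
  · refine unif (fun i p => Q i p.1 p.2) _ (fun j => (hQ j).1) ?_
    intro ε hε
    obtain ⟨N, hN⟩ := hQl ε hε
    exact ⟨N, fun i hi p => hN i hi p.1 p.2⟩
  · intro B hB ε hε
    obtain ⟨N, hN⟩ := hQl (ε/2) (by positivity)
    obtain ⟨r, hr⟩ := (hQ N).2 B hB (ε/2) (by positivity)
    refine ⟨r, fun t ht x hx => ?_⟩
    have h1 := hN N le_rfl t x
    have h2 := hr t ht x hx
    have h3 := norm_sub_le (Q N t x) (Q N t x - (F t x - g (t, x)))
    rw [sub_sub_cancel] at h3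
    linarith
  · intro t x
    simp
end
end

section
/- Let R be a nonempty collection of sequences in ℝⁿ closed under taking subsequences. Let f : ℝⁿ → ℝ be bounded, continuous and R-multi-almost automorphic, and let u : ℝⁿ → ℝ be bounded and continuous and solve the Poisson equation Δu = f in the distributional sense, i.e. ∫_{ℝⁿ} u(x) Δφ(x) dx = ∫_{ℝⁿ} f(x) φ(x) dx for every smooth compactly supported φ : ℝⁿ → ℝ. Then u is compactly R-multi-almost automorphic. -/
open Filter Topology MeasureTheory

noncomputable section

/-- `g : ℝⁿ → X` is `R`-multi-almost automorphic. -/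
def MultiAA1 {n : ℕ} {X : Type*} [NormedAddCommGroup X]
    (R : Set (ℕ → EuclideanSpace ℝ (Fin n))) (g : EuclideanSpace ℝ (Fin n) → X) : Prop :=
  Continuous g ∧
  ∀ b ∈ R, ∃ k : ℕ → ℕ, StrictMono k ∧ ∃ gs : EuclideanSpace ℝ (Fin n) → X,
    (∀ t, Tendsto (fun l => g (t + b (k l))) atTop (𝓝 (gs t))) ∧
    (∀ t, Tendsto (fun l => gs (t - b (k l))) atTop (𝓝 (g t)))

/-- `u : ℝⁿ → X` is compactly `R`-multi-almost automorphic: both limits hold uniformly on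
compact subsets of `ℝⁿ`. -/
def CompactMultiAA1 {n : ℕ} {X : Type*} [NormedAddCommGroup X]
    (R : Set (ℕ → EuclideanSpace ℝ (Fin n))) (u : EuclideanSpace ℝ (Fin n) → X) : Prop :=
  Continuous u ∧
  ∀ b ∈ R, ∃ k : ℕ → ℕ, StrictMono k ∧ ∃ us : EuclideanSpace ℝ (Fin n) → X,
    (∀ C : Set (EuclideanSpace ℝ (Fin n)), IsCompact C →
      TendstoUniformlyOn (fun j t => u (t + b (k j))) us atTop C) ∧
    (∀ C : Set (EuclideanSpace ℝ (Fin n)), IsCompact C →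
      TendstoUniformlyOn (fun j t => us (t - b (k j))) u atTop C)

/-- The Laplacian `Δφ = ∑ i ∂²φ/∂x_i²` of a scalar function on `ℝⁿ`. -/
def laplacian {n : ℕ} (φ : EuclideanSpace ℝ (Fin n) → ℝ) (x : EuclideanSpace ℝ (Fin n)) : ℝ :=
  ∑ i : Fin n,
    fderiv ℝ (fun y => fderiv ℝ φ y (EuclideanSpace.single i (1 : ℝ))) x
      (EuclideanSpace.single i (1 : ℝ))

lemma second_deriv_nonpos {w w1 : ℝ → ℝ} {c : ℝ} (h1 : ∀ t, HasDerivAt w (w1 t) t)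
    (h2 : HasDerivAt w1 c 0) (hmax : IsLocalMax w 0) : c ≤ 0 := by
  by_contra! hc
  have hd : deriv w = w1 := funext fun t => (h1 t).deriv
  have h0 : deriv w 0 = 0 := hmax.deriv_eq_zero
  have hmin : IsLocalMin w 0 := isLocalMin_of_deriv_deriv_pos (by rw [hd, h2.deriv]; exact hc) h0
    (h1 0).continuousAt
  have heq : w =ᶠ[𝓝 0] fun _ => w 0 := by
    filter_upwards [hmax, hmin] with t ha hb using le_antisymm ha hb
  have h3 : w1 =ᶠ[𝓝 0] fun _ => 0 := by
    have := heq.deriv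
    rw [hd] at this
    simpa using this
  have h4 := h3.deriv_eq
  rw [h2.deriv] at h4
  simp at h4
  linarith

lemma laplacian_eq_basis {n : ℕ} {U : EuclideanSpace ℝ (Fin n) → ℝ} (hU : ContDiff ℝ 2 U)
    (v : OrthonormalBasis (Fin n) ℝ (EuclideanSpace ℝ (Fin n))) (x : EuclideanSpace ℝ (Fin n)) :
    laplacian U x = ∑ i, fderiv ℝ (fderiv ℝ U) x (v i) (v i) := by
  have h1 := congrFun (InnerProductSpace.laplacian_eq_iteratedFDeriv_orthonormalBasis U v) x
  have h2 := congrFun (InnerProductSpace.laplacian_eq_iteratedFDeriv_orthonormalBasis U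
    (EuclideanSpace.basisFun (Fin n) ℝ)) x
  rw [h1] at h2
  simp only [iteratedFDeriv_two_apply, EuclideanSpace.basisFun_apply, Matrix.cons_val_zero,
    Matrix.cons_val_one] at h2
  rw [h2]
  unfold laplacian
  refine Finset.sum_congr rfl fun i _ => ?_
  have hd : DifferentiableAt ℝ (fderiv ℝ U) x :=
    ((hU.fderiv_right (m := 1) (by norm_num)).differentiable (by norm_num)) x
  rw [fderiv_clm_apply hd (by fun_prop)]
  simp

lemma line_deriv1 {n : ℕ} {U : EuclideanSpace ℝ (Fin n) → ℝ} (hU : ContDiff ℝ 2 U)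
    (q v : EuclideanSpace ℝ (Fin n)) (t : ℝ) :
    HasDerivAt (fun t : ℝ => U (q + t • v)) (fderiv ℝ U (q + t • v) v) t := by
  have h : HasDerivAt (fun t : ℝ => q + t • v) v t := by
    simpa using ((hasDerivAt_id t).smul_const v).const_add q
  exact ((hU.differentiable (by norm_num)) _).hasFDerivAt.comp_hasDerivAt t h

lemma line_deriv2 {n : ℕ} {U : EuclideanSpace ℝ (Fin n) → ℝ} (hU : ContDiff ℝ 2 U)
    (q v : EuclideanSpace ℝ (Fin n)) :
    HasDerivAt (fun t : ℝ => fderiv ℝ U (q + t • v) v) (fderiv ℝ (fderiv ℝ U) q v v) 0 := by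
  have h : HasDerivAt (fun t : ℝ => q + t • v) v 0 := by
    simpa using ((hasDerivAt_id (0:ℝ)).smul_const v).const_add q
  have hd : DifferentiableAt ℝ (fderiv ℝ U) (q + (0:ℝ) • v) :=
    ((hU.fderiv_right (m := 1) (by norm_num)).differentiable (by norm_num)) _
  have h2 : HasDerivAt (fun t : ℝ => fderiv ℝ U (q + t • v))
      (fderiv ℝ (fderiv ℝ U) (q + (0:ℝ) • v) v) 0 :=
    hd.hasFDerivAt.comp_hasDerivAt (0:ℝ) h
  have h3 := ((ContinuousLinearMap.apply ℝ ℝ v).hasFDerivAt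
    (x := fderiv ℝ U (q + (0:ℝ) • v))).comp_hasDerivAt (0:ℝ) h2
  have h4 : q + (0:ℝ) • v = q := by simp
  rw [h4] at h3
  exact h3

lemma strip_estimate {n : ℕ} {U : EuclideanSpace ℝ (Fin n) → ℝ} (hU : ContDiff ℝ 2 U)
    {M F d : ℝ} (hd : 0 < d) (hM : ∀ x, |U x| ≤ M) (hF : ∀ x, |laplacian U x| ≤ F)
    (p e : EuclideanSpace ℝ (Fin n)) (he : ‖e‖ = 1) (σ : EuclideanSpace ℝ (Fin n) ≃ₗᵢ[ℝ] EuclideanSpace ℝ (Fin n))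
    (hσ : σ = (ℝ ∙ e)ᗮ.reflection) {δ : ℝ} (hδ : 0 < δ)
    (x1 : EuclideanSpace ℝ (Fin n)) (h0 : 0 ≤ inner ℝ e x1) (h1 : inner ℝ e x1 ≤ d) :
    U (p + x1) - U (p + σ x1) - (2 * M / d * inner ℝ e x1 + F * inner ℝ e x1 * (d - inner ℝ e x1))
      - δ * (‖x1‖ ^ 2 - (n + 1) * (inner ℝ e x1) ^ 2 + (n + 1) * d ^ 2) ≤ 0 := by
  have hM0 : 0 ≤ M := (abs_nonneg _).trans (hM 0)
  have hF0 : 0 ≤ F := (abs_nonneg _).trans (hF 0)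
  set W : EuclideanSpace ℝ (Fin n) → ℝ := fun x =>
    U (p + x) - U (p + σ x) - (2 * M / d * inner ℝ e x + F * inner ℝ e x * (d - inner ℝ e x))
      - δ * (‖x‖ ^ 2 - (n + 1) * (inner ℝ e x) ^ 2 + (n + 1) * d ^ 2) with hW
  change W x1 ≤ 0
  by_contra! hpos
  have hUc : Continuous U := hU.continuous
  have hWc : Continuous W := by
    have : Continuous σ := σ.continuous
    fun_prop
  have hbound : ∀ x, 0 ≤ inner ℝ e x → inner ℝ e x ≤ d → W x ≤ 2 * M - δ * ‖x‖ ^ 2 := by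
    intro x ha hb
    have h3 := (abs_le.1 (hM (p + x))).2
    have h4 := (abs_le.1 (hM (p + σ x))).1
    have h5 : 0 ≤ 2 * M / d * inner ℝ e x := by positivity
    have h6 : 0 ≤ F * inner ℝ e x * (d - inner ℝ e x) :=
      mul_nonneg (mul_nonneg hF0 ha) (by linarith)
    have h7 : (inner ℝ e x) ^ 2 ≤ d ^ 2 := by gcongr
    have h8 : 0 ≤ δ * ((n + 1) * (d ^ 2 - (inner ℝ e x) ^ 2)) :=
      mul_nonneg hδ.le (mul_nonneg (by positivity) (by linarith))
    simp only [hW]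
    nlinarith
  obtain ⟨r, hr1, hr2, hr0⟩ : ∃ r : ℝ, ‖x1‖ ≤ r ∧ 2 * M ≤ δ * r ^ 2 ∧ 0 ≤ r := by
    refine ⟨max ‖x1‖ (max 1 (2 * M / δ)), le_max_left _ _, ?_, by positivity⟩
    set r := max ‖x1‖ (max 1 (2 * M / δ))
    have ha : 1 ≤ r := (le_max_left _ _).trans (le_max_right _ _)
    have hb : 2 * M / δ ≤ r := (le_max_right _ _).trans (le_max_right _ _)
    rw [div_le_iff₀ hδ] at hb
    nlinarith [mul_le_mul_of_nonneg_left ha (by positivity : 0 ≤ δ * r)]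
  set K : Set (EuclideanSpace ℝ (Fin n)) := Metric.closedBall 0 r ∩ {x | 0 ≤ inner ℝ e x ∧ inner ℝ e x ≤ d}
  have hK : IsCompact K := by
    refine (isCompact_closedBall _ _).inter_right ?_
    have hc : Continuous fun x : EuclideanSpace ℝ (Fin n) => inner ℝ e x := by fun_prop
    exact (isClosed_le continuous_const hc).inter (isClosed_le hc continuous_const)
  have hx1K : x1 ∈ K := ⟨by simpa using hr1, h0, h1⟩
  obtain ⟨x0, ⟨hx0r, hx0a, hx0b⟩, hmax⟩ := hK.exists_isMaxOn ⟨x1, hx1K⟩ hWc.continuousOn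
  have hW0 : 0 < W x0 := hpos.trans_le (hmax hx1K)
  have hb0 := hbound x0 hx0a hx0b
  have hx0r' : ‖x0‖ ≤ r := by simpa using hx0r
  have hxr : ‖x0‖ < r := by
    rcases hx0r'.lt_or_eq with h | h
    · exact h
    · rw [h] at hb0; linarith
  have hxa : 0 < inner ℝ e x0 := by
    rcases hx0a.lt_or_eq with h | h
    · exact h
    · exfalso
      have hfix : σ x0 = x0 := by
        rw [hσ]
        apply Submodule.reflection_mem_subspace_eq_self
        rw [Submodule.mem_orthogonal_singleton_iff_inner_right]
        exact h.symm
      simp only [hW, hfix, ← h] at hW0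
      have : 0 ≤ δ * (‖x0‖ ^ 2 + (n + 1) * d ^ 2) := by positivity
      nlinarith
  have hxb : inner ℝ e x0 < d := by
    rcases hx0b.lt_or_eq with h | h
    · exact h
    · exfalso
      simp only [hW, h] at hW0
      have h3 := (abs_le.1 (hM (p + x0))).2
      have h4 := (abs_le.1 (hM (p + σ x0))).1
      have h5 : 2 * M / d * d = 2 * M := by field_simp
      have : 0 ≤ δ * (‖x0‖ ^ 2) := by positivity
      rw [h5] at hW0
      nlinarith
  have hloc : IsLocalMax W x0 := by
    refine hmax.isLocalMax ?_
    refine Filter.inter_mem ?_ (Filter.inter_mem ?_ ?_)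
    · exact Metric.closedBall_mem_nhds_of_mem (by simpa using hxr)
    · have : ∀ᶠ x in 𝓝 x0, 0 < inner ℝ e x :=
        (isOpen_lt continuous_const (by fun_prop)).mem_nhds hxa
      filter_upwards [this] with x hx using hx.le
    · have : ∀ᶠ x in 𝓝 x0, inner ℝ e x < d :=
        (isOpen_lt (by fun_prop) continuous_const).mem_nhds hxb
      filter_upwards [this] with x hx using hx.le
  have key : ∀ v : EuclideanSpace ℝ (Fin n), ‖v‖ = 1 →
      fderiv ℝ (fderiv ℝ U) (p + x0) v v - fderiv ℝ (fderiv ℝ U) (p + σ x0) (σ v) (σ v)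
      + 2 * F * (inner ℝ e v) ^ 2 - δ * (2 - 2 * (n + 1) * (inner ℝ e v) ^ 2) ≤ 0 := by
    intro v hv
    set s : ℝ := inner ℝ e x0 with hs
    set a : ℝ := inner ℝ e v with ha
    set m : ℝ := inner ℝ x0 v with hm
    have hnorm : ∀ t : ℝ, ‖x0 + t • v‖ ^ 2 = ‖x0‖ ^ 2 + 2 * m * t + t ^ 2 := by
      intro t
      rw [norm_add_sq_real, norm_smul, inner_smul_right, hv, mul_one, Real.norm_eq_abs, sq_abs]
      ring
    have hinn : ∀ t : ℝ, inner ℝ e (x0 + t • v) = s + t * a := by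
      intro t
      rw [inner_add_right, inner_smul_right]
    have hfun : (fun t : ℝ => W (x0 + t • v)) = fun t : ℝ =>
        U (p + x0 + t • v) - U (p + σ x0 + t • σ v)
        - (2 * M / d * (s + t * a) + F * (s + t * a) * (d - (s + t * a)))
        - δ * ((‖x0‖ ^ 2 + 2 * m * t + t ^ 2) - (n + 1) * (s + t * a) ^ 2 + (n + 1) * d ^ 2) := by
      funext t
      simp only [hW, hnorm, hinn, map_add, map_smul, add_assoc]
    have hp : ∀ t : ℝ, HasDerivAt (fun t : ℝ => 
        (2 * M / d * (s + t * a) + F * (s + t * a) * (d - (s + t * a)))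
        + δ * ((‖x0‖ ^ 2 + 2 * m * t + t ^ 2) - (n + 1) * (s + t * a) ^ 2 + (n + 1) * d ^ 2))
        (2 * M / d * a + F * a * (d - 2 * (s + t * a))
          + δ * (2 * m + 2 * t - 2 * (n + 1) * (s + t * a) * a)) t := by
      intro t
      have hl : HasDerivAt (fun t : ℝ => s + t * a) a t := by
        simpa using ((hasDerivAt_id t).mul_const a).const_add s
      have h := ((hl.const_mul (2 * M / d)).add ((hl.const_mul F).mul (hl.const_sub d))).add
        ((((((hasDerivAt_id t).const_mul (2 * m)).const_add (‖x0‖ ^ 2)).add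
          ((hasDerivAt_id t).pow 2)).sub ((hl.pow 2).const_mul ((n : ℝ) + 1))).add_const
            (((n : ℝ) + 1) * d ^ 2) |>.const_mul δ)
      refine (h.congr_deriv ?_)
      simp
      ring
    have hp2 : HasDerivAt (fun t : ℝ => 2 * M / d * a + F * a * (d - 2 * (s + t * a))
          + δ * (2 * m + 2 * t - 2 * (n + 1) * (s + t * a) * a))
          (- 2 * F * a ^ 2 + δ * (2 - 2 * (n + 1) * a ^ 2)) 0 := by
      have hl : HasDerivAt (fun t : ℝ => s + t * a) a 0 := by
        simpa using ((hasDerivAt_id (0:ℝ)).mul_const a).const_add s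
      have h := ((((hl.const_mul 2).const_sub d).const_mul (F * a)).const_add (2 * M / d * a)).add
        ((((hasDerivAt_id (0:ℝ)).const_mul 2).const_add (2 * m)).sub
          ((hl.const_mul (2 * ((n : ℝ) + 1))).mul_const a) |>.const_mul δ)
      refine (h.congr_deriv ?_)
      ring
    have hlm : IsLocalMax (fun t : ℝ => W (x0 + t • v)) 0 := by
      have hc : ContinuousAt (fun t : ℝ => x0 + t • v) 0 := by fun_prop
      have hl' : IsLocalMax W (x0 + (0:ℝ) • v) := by simpa using hloc
      exact hc.tendsto.eventually hl'
    have := second_deriv_nonpos (w := fun t : ℝ => W (x0 + t • v))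
      (fun t => by
        rw [hfun]
        refine (((line_deriv1 hU (p + x0) v t).sub (line_deriv1 hU (p + σ x0) (σ v) t)).sub (hp t)).congr_of_eventuallyEq (Eventually.of_forall fun t => ?_)
        simp only [Pi.sub_apply]
        ring)
      (((line_deriv2 hU (p + x0) v).sub (line_deriv2 hU (p + σ x0) (σ v))).sub hp2) hlm
    linarith
  let b := EuclideanSpace.basisFun (Fin n) ℝ
  have hsum : ∑ i, (fderiv ℝ (fderiv ℝ U) (p + x0) (b i) (b i)
      - fderiv ℝ (fderiv ℝ U) (p + σ x0) (σ (b i)) (σ (b i))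
      + 2 * F * (inner ℝ e (b i)) ^ 2 - δ * (2 - 2 * (n + 1) * (inner ℝ e (b i)) ^ 2)) ≤ 0 :=
    Finset.sum_nonpos fun i _ => key (b i) (b.norm_eq_one i)
  have hL1 := laplacian_eq_basis hU b (p + x0)
  have hL2 := laplacian_eq_basis hU (b.map σ) (p + σ x0)
  simp only [OrthonormalBasis.map_apply] at hL2
  have hpars := b.sum_sq_inner_left e
  rw [he] at hpars
  simp only [Finset.sum_sub_distrib, Finset.sum_add_distrib, ← Finset.mul_sum, hpars, ← hL1, ← hL2]
    at hsum
  simp at hsum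
  have h3 := (abs_le.1 (hF (p + x0))).1
  have h4 := (abs_le.1 (hF (p + σ x0))).2
  nlinarith

/-- The gradient type estimate for smooth functions. -/
lemma smooth_estimate {n : ℕ} {U : EuclideanSpace ℝ (Fin n) → ℝ} (hU : ContDiff ℝ 2 U)
    {M F d : ℝ} (hd : 0 < d) (hM : ∀ x, |U x| ≤ M) (hF : ∀ x, |laplacian U x| ≤ F)
    (x y : EuclideanSpace ℝ (Fin n)) (hxy : ‖x - y‖ ≤ d) :
    U x - U y ≤ ‖x - y‖ * (M / d + F * d) := by
  have hM0 : 0 ≤ M := (abs_nonneg _).trans (hM 0)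
  have hF0 : 0 ≤ F := (abs_nonneg _).trans (hF 0)
  rcases eq_or_ne x y with rfl | hne
  · simp
  have hpos : 0 < ‖x - y‖ := norm_pos_iff.2 (sub_ne_zero.2 hne)
  set ℓ := ‖x - y‖ with hl
  set e : EuclideanSpace ℝ (Fin n) := ℓ⁻¹ • (x - y) with he
  have he1 : ‖e‖ = 1 := by
    rw [he, norm_smul, norm_inv, Real.norm_of_nonneg hpos.le, ← hl, inv_mul_cancel₀ hpos.ne']
  set p : EuclideanSpace ℝ (Fin n) := (1 / 2 : ℝ) • (x + y) with hp
  have hle : ℓ • e = x - y := by rw [he, smul_smul, mul_inv_cancel₀ hpos.ne', one_smul]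
  have hx : p + (ℓ / 2) • e = x := by
    rw [show (ℓ / 2) • e = (1 / 2 : ℝ) • (ℓ • e) by clear_value e ℓ; module, hle, hp]
    module
  have hy : p + -((ℓ / 2) • e) = y := by
    rw [show (ℓ / 2) • e = (1 / 2 : ℝ) • (ℓ • e) by clear_value e ℓ; module, hle, hp]
    module
  have hin : inner ℝ e ((ℓ / 2) • e) = ℓ / 2 := by
    rw [inner_smul_right, real_inner_self_eq_norm_sq, he1]; ring
  set A := (‖(ℓ / 2) • e‖ ^ 2 - (n + 1) * (ℓ / 2) ^ 2 + (n + 1) * d ^ 2)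
  have hst : ∀ δ : ℝ, 0 < δ → U x - U y - (2 * M / d * (ℓ / 2) + F * (ℓ / 2) * (d - ℓ / 2)) - δ * A ≤ 0 := by
    intro δ hδ
    have := strip_estimate hU hd hM hF p e he1 (ℝ ∙ e)ᗮ.reflection rfl hδ ((ℓ / 2) • e)
      (by rw [hin]; positivity) (by rw [hin]; linarith)
    rw [hin, map_smul, Submodule.reflection_orthogonalComplement_singleton_eq_neg, smul_neg, hx, hy] at this
    exact this
  have hlim : Tendsto (fun δ : ℝ => U x - U y - (2 * M / d * (ℓ / 2) + F * (ℓ / 2) * (d - ℓ / 2)) - δ * A)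
      (𝓝[>] 0) (𝓝 (U x - U y - (2 * M / d * (ℓ / 2) + F * (ℓ / 2) * (d - ℓ / 2)) - 0 * A)) := by
    refine Tendsto.mono_left ?_ nhdsWithin_le_nhds
    exact Continuous.tendsto (by fun_prop) 0
  have hfin := le_of_tendsto hlim (by filter_upwards [self_mem_nhdsWithin] with δ hδ using hst δ hδ)
  have h1 : 2 * M / d * (ℓ / 2) = ℓ * (M / d) := by ring
  rw [h1] at hfin
  nlinarith [mul_nonneg hF0 (mul_nonneg hpos.le hd.le), mul_nonneg hF0 (mul_nonneg hpos.le hpos.le)]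

/-- Distributional solutions of the Poisson equation. -/
def WeakSol {n : ℕ} (u f : EuclideanSpace ℝ (Fin n) → ℝ) : Prop :=
  ∀ φ : EuclideanSpace ℝ (Fin n) → ℝ, ContDiff ℝ (⊤ : ℕ∞) φ → HasCompactSupport φ →
      ∫ x, u x * laplacian φ x = ∫ x, f x * φ x

lemma laplacian_comp_add {n : ℕ} (φ : EuclideanSpace ℝ (Fin n) → ℝ)
    (a y : EuclideanSpace ℝ (Fin n)) :
    laplacian (fun y => φ (y + a)) y = laplacian φ (y + a) := by
  unfold laplacian
  refine Finset.sum_congr rfl fun i _ => ?_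
  simp only [fderiv_comp_add_right]
  rw [fderiv_comp_add_right (f := fun y => fderiv ℝ φ y (EuclideanSpace.single i (1 : ℝ)))]

lemma fderiv_reflect {n : ℕ} {φ : EuclideanSpace ℝ (Fin n) → ℝ} (hφ : Differentiable ℝ φ)
    (x y v : EuclideanSpace ℝ (Fin n)) :
    fderiv ℝ (fun y => φ (x - y)) y v = - fderiv ℝ φ (x - y) v := by
  have h : HasFDerivAt (fun y => φ (x - y))
      ((fderiv ℝ φ (x - y)).comp (-(ContinuousLinearMap.id ℝ _))) y :=
    (hφ (x - y)).hasFDerivAt.comp y ((hasFDerivAt_id y).const_sub x)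
  rw [h.fderiv]
  simp

lemma contDiff_dir {n : ℕ} {φ : EuclideanSpace ℝ (Fin n) → ℝ} (hφ : ContDiff ℝ (⊤ : ℕ∞) φ)
    (v : EuclideanSpace ℝ (Fin n)) : ContDiff ℝ (⊤ : ℕ∞) (fun y => fderiv ℝ φ y v) :=
  (hφ.fderiv_right (m := (⊤ : ℕ∞)) (by simp)).clm_apply contDiff_const

lemma laplacian_reflect {n : ℕ} {φ : EuclideanSpace ℝ (Fin n) → ℝ} (hφ : ContDiff ℝ (⊤ : ℕ∞) φ)
    (x y : EuclideanSpace ℝ (Fin n)) :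
    laplacian (fun y => φ (x - y)) y = laplacian φ (x - y) := by
  unfold laplacian
  refine Finset.sum_congr rfl fun i _ => ?_
  simp only [fderiv_reflect (hφ.differentiable (by simp))]
  have h2 := fderiv_reflect ((contDiff_dir hφ (EuclideanSpace.single i (1 : ℝ))).differentiable
    (by simp)) x y (EuclideanSpace.single i (1 : ℝ))
  rw [fderiv_fun_neg, neg_apply, h2, neg_neg]

lemma continuous_laplacian {n : ℕ} {φ : EuclideanSpace ℝ (Fin n) → ℝ}
    (hφ : ContDiff ℝ (⊤ : ℕ∞) φ) : Continuous (laplacian φ) := by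
  unfold laplacian
  exact continuous_finsetSum _ fun i _ => (contDiff_dir (contDiff_dir hφ _) _).continuous

lemma hasCompactSupport_laplacian {n : ℕ} {φ : EuclideanSpace ℝ (Fin n) → ℝ}
    (hφ : HasCompactSupport φ) : HasCompactSupport (laplacian φ) := by
  refine HasCompactSupport.intro (K := tsupport φ) hφ fun x hx => ?_
  unfold laplacian
  refine Finset.sum_eq_zero fun i _ => ?_
  have h1 : x ∉ tsupport (fun y => fderiv ℝ φ y (EuclideanSpace.single i (1 : ℝ))) :=
    fun h => hx (tsupport_fderiv_apply_subset ℝ _ h)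
  have h2 : x ∉ tsupport (fun y => fderiv ℝ (fun y => fderiv ℝ φ y (EuclideanSpace.single i (1 : ℝ))) y
      (EuclideanSpace.single i (1 : ℝ))) :=
    fun h => h1 (tsupport_fderiv_apply_subset ℝ _ h)
  exact image_eq_zero_of_notMem_tsupport (f := fun y =>
    fderiv ℝ (fun y => fderiv ℝ φ y (EuclideanSpace.single i (1 : ℝ))) y
      (EuclideanSpace.single i (1 : ℝ))) h2

lemma dir_convolution {n : ℕ} {u ρ : EuclideanSpace ℝ (Fin n) → ℝ} (hu : Continuous u)
    (hρ : ContDiff ℝ (⊤ : ℕ∞) ρ) (hc : HasCompactSupport ρ) (x v : EuclideanSpace ℝ (Fin n)) :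
    fderiv ℝ (convolution u ρ (ContinuousLinearMap.mul ℝ ℝ) volume) x v =
      convolution u (fun y => fderiv ℝ ρ y v) (ContinuousLinearMap.mul ℝ ℝ) volume x := by
  have h := hc.hasFDerivAt_convolution_right (ContinuousLinearMap.mul ℝ ℝ)
    (hu.locallyIntegrable (μ := volume)) (hρ.of_le (by simp)) x
  rw [h.fderiv, convolution_precompR_apply _ hu.locallyIntegrable (hc.fderiv ℝ)
    (hρ.continuous_fderiv (by simp))]

lemma laplacian_convolution {n : ℕ} {u f ρ : EuclideanSpace ℝ (Fin n) → ℝ} (hu : Continuous u)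
    (hw : WeakSol u f)
    (hρ : ContDiff ℝ (⊤ : ℕ∞) ρ) (hc : HasCompactSupport ρ) (x : EuclideanSpace ℝ (Fin n)) :
    laplacian (convolution u ρ (ContinuousLinearMap.mul ℝ ℝ) volume) x =
      ∫ y, f y * ρ (x - y) := by
  have h1 : laplacian (convolution u ρ (ContinuousLinearMap.mul ℝ ℝ) volume) x =
      ∫ y, u y * laplacian ρ (x - y) := by
    unfold laplacian
    simp only [dir_convolution hu hρ hc]
    simp only [Finset.mul_sum]
    rw [integral_finsetSum]
    · refine Finset.sum_congr rfl fun i _ => ?_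
      rw [dir_convolution hu (contDiff_dir hρ _) (hc.fderiv_apply ℝ _)]
      rfl
    · intro i _
      refine Continuous.integrable_of_hasCompactSupport ?_ ?_
      · exact hu.mul ((contDiff_dir (contDiff_dir hρ _) _).continuous.comp (by fun_prop))
      · refine HasCompactSupport.mul_left ?_
        exact ((hc.fderiv_apply ℝ _).fderiv_apply ℝ _).comp_homeomorph (Homeomorph.subLeft x)
  rw [h1]
  have h2 := hw (fun y => ρ (x - y)) (hρ.comp (by fun_prop))
    (hc.comp_homeomorph (Homeomorph.subLeft x))
  simpa only [laplacian_reflect hρ] using h2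

lemma mollify_bound {n : ℕ} {g ρ : EuclideanSpace ℝ (Fin n) → ℝ} {C : ℝ} (hg : ∀ x, |g x| ≤ C)
    (hρ : Continuous ρ) (hc : HasCompactSupport ρ) (h0 : ∀ x, 0 ≤ ρ x) (h1 : ∫ x, ρ x = 1)
    (x : EuclideanSpace ℝ (Fin n)) : |∫ y, g y * ρ (x - y)| ≤ C := by
  have hi : Integrable (fun y => C * ρ (x - y)) :=
    ((hρ.integrable_of_hasCompactSupport hc).comp_sub_left x).const_mul C
  have := norm_integral_le_of_norm_le (f := fun y => g y * ρ (x - y)) hi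
    (Eventually.of_forall fun y => by
      rw [norm_mul, Real.norm_of_nonneg (h0 _), Real.norm_eq_abs]
      exact mul_le_mul_of_nonneg_right (hg y) (h0 _))
  rw [integral_const_mul, integral_sub_left_eq_self, h1, mul_one] at this
  exact this

lemma weak_estimate {n : ℕ} {u f : EuclideanSpace ℝ (Fin n) → ℝ} (hu : Continuous u)
    (hw : WeakSol u f)
    {M F d : ℝ} (hd : 0 < d) (hM : ∀ x, |u x| ≤ M) (hF : ∀ x, |f x| ≤ F)
    (x y : EuclideanSpace ℝ (Fin n)) (hxy : ‖x - y‖ ≤ d) :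
    u x - u y ≤ ‖x - y‖ * (M / d + F * d) := by
  let φ : ℕ → ContDiffBump (0 : EuclideanSpace ℝ (Fin n)) := fun k =>
    ⟨1 / ((k : ℝ) + 1) / 2, 1 / ((k : ℝ) + 1), by positivity, half_lt_self (by positivity)⟩
  have hφ : Tendsto (fun k => (φ k).rOut) atTop (𝓝 0) := tendsto_one_div_add_atTop_nhds_zero_nat
  let U : ℕ → EuclideanSpace ℝ (Fin n) → ℝ := fun k =>
    convolution u ((φ k).normed volume) (ContinuousLinearMap.mul ℝ ℝ) volume
  have hU : ∀ k, U k = convolution ((φ k).normed volume) u (ContinuousLinearMap.lsmul ℝ ℝ) volume := by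
    intro k
    rw [← convolution_flip]
    have : (ContinuousLinearMap.lsmul ℝ ℝ : ℝ →L[ℝ] ℝ →L[ℝ] ℝ).flip = ContinuousLinearMap.mul ℝ ℝ := by
      ext; simp
    rw [this]
  have hlim : ∀ z, Tendsto (fun k => U k z) atTop (𝓝 (u z)) := by
    intro z
    simp only [hU]
    exact ContDiffBump.convolution_tendsto_right_of_continuous hφ hu z
  refine le_of_tendsto ((hlim x).sub (hlim y)) (Eventually.of_forall fun k => ?_)
  have hs : ContDiff ℝ (⊤ : ℕ∞) ((φ k).normed volume) := (φ k).contDiff_normed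
  have hc : HasCompactSupport ((φ k).normed volume) := (φ k).hasCompactSupport_normed
  have hC : ContDiff ℝ (⊤ : ℕ∞) (U k) :=
    hc.contDiff_convolution_right _ hu.locallyIntegrable hs
  refine smooth_estimate (hC.of_le (WithTop.coe_le_coe.2 (le_top : (2 : ℕ∞) ≤ ⊤))) hd (fun z => ?_) (fun z => ?_) x y hxy
  · exact mollify_bound hM hs.continuous hc (φ k).nonneg_normed (φ k).integral_normed z
  · simp only [U]
    rw [laplacian_convolution hu hw hs hc]
    exact mollify_bound hF hs.continuous hc (φ k).nonneg_normed (φ k).integral_normed z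

lemma weak_limit {n : ℕ} {u f us fs : EuclideanSpace ℝ (Fin n) → ℝ} (hum : Measurable u)
    (hfm : Measurable f) {M F : ℝ} (hM : ∀ x, |u x| ≤ M) (hF : ∀ x, |f x| ≤ F)
    (hw : WeakSol u f) (c : ℕ → EuclideanSpace ℝ (Fin n))
    (hul : ∀ t, Tendsto (fun l => u (t + c l)) atTop (𝓝 (us t)))
    (hfl : ∀ t, Tendsto (fun l => f (t + c l)) atTop (𝓝 (fs t))) : WeakSol us fs := by
  intro φ hφ hc
  have gen : ∀ (g gs ψ : EuclideanSpace ℝ (Fin n) → ℝ) (C : ℝ), Measurable g → (∀ x, |g x| ≤ C) →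
      (∀ t, Tendsto (fun l => g (t + c l)) atTop (𝓝 (gs t))) → Continuous ψ → HasCompactSupport ψ →
      Tendsto (fun l => ∫ x, g (x + c l) * ψ x) atTop (𝓝 (∫ x, gs x * ψ x)) := by
    intro g gs ψ C hg hC hl hψ hψc
    refine tendsto_integral_of_dominated_convergence (fun x => C * ‖ψ x‖) ?_ ?_ ?_ ?_
    · intro l
      exact ((hg.comp (measurable_id.add_const _)).mul hψ.measurable).aestronglyMeasurable
    · exact (hψ.integrable_of_hasCompactSupport hψc).norm.const_mul C
    · intro l
      refine Eventually.of_forall fun x => ?_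
      rw [norm_mul]
      exact mul_le_mul_of_nonneg_right (hC _) (norm_nonneg _)
    · exact Eventually.of_forall fun x => (hl x).mul_const _
  have h1 := gen u us (laplacian φ) M hum hM hul (continuous_laplacian hφ)
    (hasCompactSupport_laplacian hc)
  have h2 := gen f fs φ F hfm hF hfl hφ.continuous hc
  refine tendsto_nhds_unique h1 (h2.congr fun l => ?_)
  have h3 := hw (fun y => φ (y + - c l)) (hφ.comp (by fun_prop))
    (hc.comp_homeomorph (Homeomorph.addRight (- c l)))
  simp only [laplacian_comp_add] at h3
  rw [← integral_add_right_eq_self (fun x => u x * laplacian φ (x + - c l)) (c l),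
    ← integral_add_right_eq_self (fun x => f x * φ (x + - c l)) (c l)] at h3
  simpa using h3.symm

lemma liouville {n : ℕ} {u v f : EuclideanSpace ℝ (Fin n) → ℝ} (hu : Continuous u)
    (hv : Continuous v) {M : ℝ} (hM : ∀ x, |u x| ≤ M) (hM' : ∀ x, |v x| ≤ M)
    (hwu : WeakSol u f) (hwv : WeakSol v f) (x y : EuclideanSpace ℝ (Fin n)) :
    v x - u x ≤ v y - u y := by
  have hw : WeakSol (fun x => v x - u x) (fun _ => 0) := by
    intro φ hφ hc
    have hi : ∀ g : EuclideanSpace ℝ (Fin n) → ℝ, Continuous g →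
        Integrable (fun x => g x * laplacian φ x) := fun g hg =>
      (hg.mul (continuous_laplacian hφ)).integrable_of_hasCompactSupport
        ((hasCompactSupport_laplacian hc).mul_left)
    simp only [sub_mul, zero_mul]
    rw [integral_sub (hi v hv) (hi u hu), hwu φ hφ hc, hwv φ hφ hc]
    simp
  have hb : ∀ x, |v x - u x| ≤ 2 * M := fun x => by
    have h1 := abs_le.1 (hM x)
    have h2 := abs_le.1 (hM' x)
    rw [abs_le]; constructor <;> linarith
  have hlim : Tendsto (fun d : ℝ => ‖x - y‖ * (2 * M / d + 0 * d)) atTop (𝓝 (‖x - y‖ * 0)) := by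
    refine Tendsto.const_mul _ ?_
    simpa using (tendsto_const_nhds (x := 2 * M)).div_atTop tendsto_id
  have := ge_of_tendsto hlim (by
    filter_upwards [eventually_gt_atTop 0, eventually_ge_atTop ‖x - y‖] with d hd hd'
    exact weak_estimate (hv.sub hu) hw hd hb (by simp) x y hd')
  simp only [Pi.sub_apply] at this
  linarith

lemma weak_lipschitz {n : ℕ} {u f : EuclideanSpace ℝ (Fin n) → ℝ} (hu : Continuous u)
    (hw : WeakSol u f) {M F : ℝ} (hM : ∀ x, |u x| ≤ M) (hF : ∀ x, |f x| ≤ F) :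
    ∃ K, LipschitzWith K u := by
  have hM0 : 0 ≤ M := (abs_nonneg _).trans (hM 0)
  have hF0 : 0 ≤ F := (abs_nonneg _).trans (hF 0)
  refine ⟨(2 * M + F).toNNReal, LipschitzWith.of_le_add_mul _ fun x y => ?_⟩
  rw [Real.coe_toNNReal _ (by positivity), dist_eq_norm]
  rcases le_total ‖x - y‖ 1 with h | h
  · have := weak_estimate hu hw one_pos hM hF x y h
    nlinarith [norm_nonneg (x - y), mul_nonneg hM0 (norm_nonneg (x - y))]
  · have h1 := abs_le.1 (hM x)
    have h2 := abs_le.1 (hM y)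
    nlinarith [mul_nonneg hF0 (norm_nonneg (x - y))]

lemma arzela {n : ℕ} {K : NNReal} {M : ℝ} (g : ℕ → EuclideanSpace ℝ (Fin n) → ℝ)
    (hK : ∀ j, LipschitzWith K (g j)) (hM : ∀ j x, |g j x| ≤ M) :
    ∃ k : ℕ → ℕ, StrictMono k ∧ ∃ gs : EuclideanSpace ℝ (Fin n) → ℝ, LipschitzWith K gs ∧
      (∀ x, |gs x| ≤ M) ∧ ∀ C : Set (EuclideanSpace ℝ (Fin n)), IsCompact C →
        TendstoUniformlyOn (fun j => g (k j)) gs atTop C := by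
  let S : Set C(EuclideanSpace ℝ (Fin n), ℝ) := {h | LipschitzWith K h ∧ ∀ x, |h x| ≤ M}
  have hS : IsCompact S := by
    apply ArzelaAscoli.isCompact_of_equicontinuous
    · have himg : ContinuousMap.toFun '' S =
          {h : EuclideanSpace ℝ (Fin n) → ℝ | LipschitzWith K h} ∩
            Set.univ.pi fun _ => Set.Icc (-M) M := by
        ext h
        constructor
        · rintro ⟨q, ⟨hq1, hq2⟩, rfl⟩
          exact ⟨hq1, fun x _ => abs_le.1 (hq2 x)⟩
        · rintro ⟨h1, h2⟩
          exact ⟨⟨h, h1.continuous⟩, ⟨h1, fun x => abs_le.2 (h2 x trivial)⟩, rfl⟩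
      rw [himg]
      refine (isCompact_univ_pi fun _ => isCompact_Icc).inter_left ?_
      simp only [lipschitzWith_iff_dist_le_mul, Set.ofPred_forall]
      refine isClosed_iInter fun x => isClosed_iInter fun y => isClosed_le ?_ continuous_const
      exact (continuous_apply x).dist (continuous_apply y)
    · exact (LipschitzWith.uniformEquicontinuous _ K fun c => c.2.1).equicontinuous
  obtain ⟨q, hq, k, hk, hlim⟩ := hS.isSeqCompact
    (x := fun j => (⟨g j, (hK j).continuous⟩ : C(EuclideanSpace ℝ (Fin n), ℝ)))
    (fun j => ⟨hK j, hM j⟩)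
  refine ⟨k, hk, q, hq.1, hq.2, fun C hC => ?_⟩
  exact ContinuousMap.tendsto_iff_forall_isCompact_tendstoUniformlyOn.1 hlim C hC

/-- a bounded continuous distributional solution `u` of the Poisson equation
`Δu = f` with `f` bounded, continuous and `R`-multi-almost automorphic (where `R` is closed
under taking subsequences) is compactly `R`-multi-almost automorphic. -/
theorem compactMultiAA1_of_poisson {n : ℕ}
    (R : Set (ℕ → EuclideanSpace ℝ (Fin n))) (hR : R.Nonempty)
    (hRsub : ∀ b ∈ R, ∀ k : ℕ → ℕ, StrictMono k → (fun j => b (k j)) ∈ R)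
    (f u : EuclideanSpace ℝ (Fin n) → ℝ)
    (hfbdd : ∃ C : ℝ, ∀ t, |f t| ≤ C) (hfaa : MultiAA1 R f)
    (hubdd : ∃ C : ℝ, ∀ t, |u t| ≤ C) (hucont : Continuous u)
    (hsol : ∀ φ : EuclideanSpace ℝ (Fin n) → ℝ, ContDiff ℝ (⊤ : ℕ∞) φ → HasCompactSupport φ →
      ∫ x, u x * laplacian φ x = ∫ x, f x * φ x) :
    CompactMultiAA1 R u := by
  obtain ⟨F, hF⟩ := hfbdd
  obtain ⟨M, hM⟩ := hubdd
  have hw : WeakSol u f := hsol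
  obtain ⟨K, hK⟩ := weak_lipschitz hucont hw hM hF
  refine ⟨hucont, fun b hb => ?_⟩
  obtain ⟨k1, hk1, fs, hfs1, hfs2⟩ := hfaa.2 b hb
  obtain ⟨k2, hk2, us, husK, husM, hus⟩ := arzela (K := K) (M := M) (fun j t => u (t + b (k1 j)))
    (fun j => by
      refine LipschitzWith.of_dist_le_mul fun x y => ?_
      simpa using hK.dist_le_mul (x + b (k1 j)) (y + b (k1 j))) (fun j x => hM _)
  obtain ⟨k3, hk3, v, hvK, hvM, hv⟩ := arzela (K := K) (M := M)
    (fun j t => us (t - b (k1 (k2 j))))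
    (fun j => by
      refine LipschitzWith.of_dist_le_mul fun x y => ?_
      simpa using husK.dist_le_mul (x - b (k1 (k2 j))) (y - b (k1 (k2 j)))) (fun j x => husM _)
  have hup : ∀ t, Tendsto (fun j => u (t + b (k1 (k2 j)))) atTop (𝓝 (us t)) := fun t =>
    (hus {t} isCompact_singleton).tendsto_at rfl
  have hvp : ∀ t, Tendsto (fun j => us (t - b (k1 (k2 (k3 j))))) atTop (𝓝 (v t)) := fun t =>
    (hv {t} isCompact_singleton).tendsto_at rfl
  have hfm : Measurable f := hfaa.1.measurable
  have hfsm : Measurable fs := measurable_of_tendsto_metrizable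
    (f := fun l t => f (t + b (k1 l))) (fun l => hfm.comp (measurable_id.add_const _))
    (tendsto_pi_nhds.2 hfs1)
  have hfsF : ∀ x, |fs x| ≤ F := fun x =>
    le_of_tendsto (hfs1 x).abs (Eventually.of_forall fun l => hF _)
  have hws : WeakSol us fs := weak_limit hucont.measurable hfm hM hF hw (fun j => b (k1 (k2 j)))
    hup (fun t => (hfs1 t).comp hk2.tendsto_atTop)
  have hwv : WeakSol v f := weak_limit husK.continuous.measurable hfsm husM hfsF hws
    (fun j => - b (k1 (k2 (k3 j)))) (by simpa only [← sub_eq_add_neg] using hvp)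
    (fun t => by
      simp only [← sub_eq_add_neg]
      exact (hfs2 t).comp (hk2.comp hk3).tendsto_atTop)
  have hc : ∀ x, v x = u x + (v 0 - u 0) := fun x => by
    have h1 := liouville hucont hvK.continuous hM hvM hw hwv x 0
    have h2 := liouville hucont hvK.continuous hM hvM hw hwv 0 x
    linarith
  have hba : BddAbove (Set.range u) := ⟨M, by rintro _ ⟨x, rfl⟩; exact (abs_le.1 (hM x)).2⟩
  have hbb : BddBelow (Set.range u) := ⟨-M, by rintro _ ⟨x, rfl⟩; exact (abs_le.1 (hM x)).1⟩
  have husS : ∀ x, us x ≤ ⨆ y, u y := fun x =>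
    le_of_tendsto (hup x) (Eventually.of_forall fun l => le_ciSup hba _)
  have husI : ∀ x, ⨅ y, u y ≤ us x := fun x =>
    ge_of_tendsto (hup x) (Eventually.of_forall fun l => ciInf_le hbb _)
  have hvS : ∀ x, v x ≤ ⨆ y, u y := fun x =>
    le_of_tendsto (hvp x) (Eventually.of_forall fun l => husS _)
  have hvI : ∀ x, ⨅ y, u y ≤ v x := fun x =>
    ge_of_tendsto (hvp x) (Eventually.of_forall fun l => husI _)
  have h1 : ⨆ y, u y ≤ (⨆ y, u y) - (v 0 - u 0) := ciSup_le fun x => by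
    have := hvS x
    rw [hc x] at this
    linarith
  have h2 : (⨅ y, u y) - (v 0 - u 0) ≤ ⨅ y, u y := le_ciInf fun x => by
    have := hvI x
    rw [hc x] at this
    linarith
  have hvu : v = u := funext fun x => by
    rw [hc x]
    linarith
  refine ⟨fun j => k1 (k2 (k3 j)), hk1.comp (hk2.comp hk3), us, fun C hC => ?_, fun C hC => ?_⟩
  · intro V hV
    exact hk3.tendsto_atTop.eventually (hus C hC V hV)
  · rw [← hvu]
    exact hv C hC
end
end
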